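/- arXiv:math/0302334 — 2 statements merged into one kernel-verified Lean document; each statement's English description precedes it below -/
import Mathlib

section
/- Let K be a field and let U, W be vector spaces over K. For subspaces U₁, U₂ ⊆ U and W₁, W₂ ⊆ W one has the following equality of subspaces of U⊗W: (U₁⊗W + U⊗W₁) ∩ (U₂⊗W + U⊗W₂) = (U₁∩U₂)⊗W + U₁⊗W₂ + U₂⊗W₁ + U⊗(W₁∩W₂). -/
open scoped TensorProduct

/-- For subspaces `X ⊆ U` and `Y ⊆ W`, the subspace `X ⊗ Y` of `U ⊗ W` spanned by all
elements `x ⊗ y` with `x ∈ X`, `y ∈ Y`. -/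
def subTensor {K U W : Type*} [Field K] [AddCommGroup U] [Module K U]
    [AddCommGroup W] [Module K W] (X : Submodule K U) (Y : Submodule K W) :
    Submodule K (U ⊗[K] W) :=
  Submodule.span K {t | ∃ x ∈ X, ∃ y ∈ Y, t = x ⊗ₜ[K] y}

open TensorProduct in
theorem map_mem_subTensor {K U W : Type*} [Field K] [AddCommGroup U] [Module K U]
    [AddCommGroup W] [Module K W] {X : Submodule K U} {Y : Submodule K W}
    {f : Module.End K U} {g : Module.End K W} (hf : ∀ x, f x ∈ X) (hg : ∀ y, g y ∈ Y)
    (t : U ⊗[K] W) : map f g t ∈ subTensor X Y := by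
  induction t with
  | zero => simp
  | tmul x y => exact Submodule.subset_span ⟨f x, hf x, g y, hg y, map_tmul f g x y⟩
  | add s t hs ht => simpa using add_mem hs ht

open TensorProduct in
theorem map_eq_zero_of_mem_sup {K U W : Type*} [Field K] [AddCommGroup U] [Module K U]
    [AddCommGroup W] [Module K W] {X : Submodule K U} {Y : Submodule K W}
    {f : Module.End K U} {g : Module.End K W} (hf : ∀ x ∈ X, f x = 0) (hg : ∀ y ∈ Y, g y = 0)
    {t : U ⊗[K] W} (ht : t ∈ subTensor X ⊤ ⊔ subTensor ⊤ Y) : map f g t = 0 := by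
  have h : subTensor X ⊤ ⊔ subTensor ⊤ Y ≤ LinearMap.ker (map f g) := by
    refine sup_le (Submodule.span_le.2 ?_) (Submodule.span_le.2 ?_)
    · rintro _ ⟨x, hx, y, -, rfl⟩
      simp [hf x hx]
    · rintro _ ⟨x, -, y, hy, rfl⟩
      simp [hg y hy]
  exact h ht

theorem subTensor_mono {K U W : Type*} [Field K] [AddCommGroup U] [Module K U]
    [AddCommGroup W] [Module K W] {X X' : Submodule K U} {Y Y' : Submodule K W}
    (hX : X ≤ X') (hY : Y ≤ Y') : subTensor X Y ≤ subTensor X' Y' :=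
  Submodule.span_mono fun _ ⟨x, hx, y, hy, h⟩ => ⟨x, hX hx, y, hY hy, h⟩

/-- There is a projection onto `A` that maps `B` into itself. -/
theorem exists_projection_mapsTo {K U : Type*} [Field K] [AddCommGroup U] [Module K U]
    (A B : Submodule K U) :
    ∃ e : Module.End K U, (∀ x, e x ∈ A) ∧ (∀ x ∈ A, e x = x) ∧ ∀ x ∈ B, e x ∈ B := by
  obtain ⟨C, hC⟩ := (A ⊓ B).exists_isCompl
  have hdisj : Disjoint A (C ⊓ B) := by
    rw [disjoint_iff, inf_left_comm, ← inf_comm (A ⊓ B)]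
    exact hC.inf_eq_bot
  obtain ⟨Q, hQ, hQA⟩ := hdisj.symm.exists_isCompl
  have hB : (A ⊓ B) ⊔ (C ⊓ B) = B := by
    rw [← sup_inf_assoc_of_le C (inf_le_right : A ⊓ B ≤ B), hC.sup_eq_top, top_inf_eq]
  refine ⟨A.projection Q hQA.symm, Submodule.projection_apply_mem _,
    fun _ hx => Submodule.projection_apply_of_mem_left _ hx, fun x hx => ?_⟩
  rw [← hB] at hx
  obtain ⟨y, hy, z, hz, rfl⟩ := Submodule.mem_sup.1 hx
  rw [map_add, Submodule.projection_apply_of_mem_left _ hy.1,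
    (Submodule.projection_apply_eq_zero_iff _).2 (hQ hz), add_zero]
  exact hy.2

/-- The identity splits into four endomorphisms according to the position of two subspaces. -/
theorem exists_add_eq_one_of_pair {K U : Type*} [Field K] [AddCommGroup U] [Module K U]
    (A B : Submodule K U) :
    ∃ a b c d : Module.End K U, a + b + c + d = 1 ∧ (∀ x, a x ∈ A ⊓ B) ∧
      (∀ x, b x ∈ A) ∧ (∀ x ∈ B, b x = 0) ∧ (∀ x, c x ∈ B) ∧ (∀ x ∈ A, c x = 0) ∧
      (∀ x ∈ A, d x = 0) ∧ ∀ x ∈ B, d x = 0 := by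
  obtain ⟨e, heA, he, heB⟩ := exists_projection_mapsTo A B
  obtain ⟨f, hfB, hf, hfA⟩ := exists_projection_mapsTo B A
  refine ⟨e * f, e * (1 - f), (1 - e) * f, (1 - e) * (1 - f), by noncomm_ring,
    fun x => ⟨heA _, heB _ (hfB x)⟩, fun x => heA _, fun x hx => ?_,
    fun x => sub_mem (hfB x) (heB _ (hfB x)), fun x hx => ?_, fun x hx => ?_, fun x hx => ?_⟩
  · simp [hf x hx]
  · simp [he _ (hfA x hx)]
  · simp [he _ (hfA x hx), he x hx]
  · simp [hf x hx]

/-- For subspaces `U₁, U₂ ⊆ U` and `W₁, W₂ ⊆ W` one has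
`(U₁⊗W + U⊗W₁) ∩ (U₂⊗W + U⊗W₂) = (U₁∩U₂)⊗W + U₁⊗W₂ + U₂⊗W₁ + U⊗(W₁∩W₂)`. -/
theorem tensor_sum_inter {K U W : Type*} [Field K] [AddCommGroup U] [Module K U]
    [AddCommGroup W] [Module K W]
    (U₁ U₂ : Submodule K U) (W₁ W₂ : Submodule K W) :
    (subTensor U₁ (⊤ : Submodule K W) ⊔ subTensor (⊤ : Submodule K U) W₁)
      ⊓ (subTensor U₂ (⊤ : Submodule K W) ⊔ subTensor (⊤ : Submodule K U) W₂)
    = subTensor (U₁ ⊓ U₂) (⊤ : Submodule K W) ⊔ subTensor U₁ W₂ ⊔ subTensor U₂ W₁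
        ⊔ subTensor (⊤ : Submodule K U) (W₁ ⊓ W₂) := by
  apply le_antisymm
  · rintro t ⟨h₁, h₂⟩
    obtain ⟨a, b, c, d, hone, ha, hb, hb₂, hc, hc₁, hd₁, hd₂⟩ := exists_add_eq_one_of_pair U₁ U₂
    obtain ⟨a', b', c', d', hone', ha', hb', hb₂', hc', hc₁', hd₁', hd₂'⟩ :=
      exists_add_eq_one_of_pair W₁ W₂
    have ht : t = TensorProduct.map a 1 t + TensorProduct.map b c' t
        + TensorProduct.map c b' t + TensorProduct.map (b + c + d) a' t := by
      have h : t = TensorProduct.map (a + b + c + d) (a' + b' + c' + d') t := by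
        rw [hone, hone', TensorProduct.map_one, Module.End.one_apply]
      nth_rw 1 [h]
      rw [← hone']
      simp only [TensorProduct.map_add_left, TensorProduct.map_add_right, LinearMap.add_apply,
        map_eq_zero_of_mem_sup hb₂ hb₂' h₂, map_eq_zero_of_mem_sup hb₂ hd₂' h₂,
        map_eq_zero_of_mem_sup hc₁ hc₁' h₁, map_eq_zero_of_mem_sup hc₁ hd₁' h₁,
        map_eq_zero_of_mem_sup hd₂ hb₂' h₂, map_eq_zero_of_mem_sup hd₁ hc₁' h₁,
        map_eq_zero_of_mem_sup hd₁ hd₁' h₁]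
      abel
    rw [ht]
    exact Submodule.add_mem_sup (Submodule.add_mem_sup (Submodule.add_mem_sup
      (map_mem_subTensor ha (fun _ => Submodule.mem_top) t)
      (map_mem_subTensor hb hc' t)) (map_mem_subTensor hc hb' t))
      (map_mem_subTensor (fun _ => Submodule.mem_top) ha' t)
  · refine sup_le (sup_le (sup_le ?_ ?_) ?_) ?_
    · exact le_inf (le_sup_of_le_left (subTensor_mono inf_le_left le_rfl))
        (le_sup_of_le_left (subTensor_mono inf_le_right le_rfl))
    · exact le_inf (le_sup_of_le_left (subTensor_mono le_rfl le_top))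
        (le_sup_of_le_right (subTensor_mono le_top le_rfl))
    · exact le_inf (le_sup_of_le_right (subTensor_mono le_top le_rfl))
        (le_sup_of_le_left (subTensor_mono le_rfl le_top))
    · exact le_inf (le_sup_of_le_right (subTensor_mono le_rfl inf_le_left))
        (le_sup_of_le_right (subTensor_mono le_rfl inf_le_right))
end

section
/- Let K be a field, let U, W, P, P′, Q, Q′ be K-vector spaces, and let S: U→P, S′: U→P′, T: W→Q, T′: W→Q′ be K-linear maps. Then Ker(S⊗T) ∩ Ker(S′⊗T′) = (Ker S ∩ Ker S′)⊗W + (Ker S)⊗(Ker T′) + (Ker S′)⊗(Ker T) + U⊗(Ker T ∩ Ker T′), as subspaces of U⊗W. -/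
open scoped TensorProduct

/-- Every linear map over a field is von Neumann regular. -/
theorem LinearMap.exists_comp_comp_eq_self {K U P : Type*} [Field K]
    [AddCommGroup U] [Module K U] [AddCommGroup P] [Module K P] (S : U →ₗ[K] P) :
    ∃ s : P →ₗ[K] U, ∀ u, S (s (S u)) = S u := by
  obtain ⟨g, hg⟩ := S.rangeRestrict.exists_rightInverse_of_surjective S.range_rangeRestrict
  obtain ⟨s, hs⟩ := g.exists_extend
  refine ⟨s, fun u => ?_⟩
  have h₁ : s (S u) = g (S.rangeRestrict u) := LinearMap.congr_fun hs (S.rangeRestrict u)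
  rw [h₁]
  exact congrArg Subtype.val (LinearMap.congr_fun hg (S.rangeRestrict u))

/-- Given two subspaces, there is a projection onto the first one preserving the second one. -/
theorem Submodule.exists_projection_preserving {K U : Type*} [Field K]
    [AddCommGroup U] [Module K U] (A B : Submodule K U) :
    ∃ p : U →ₗ[K] U, (∀ u, p u ∈ A) ∧ (∀ u ∈ A, p u = u) ∧ ∀ u ∈ B, p u ∈ B := by
  obtain ⟨C, hC⟩ := (A ⊓ B).exists_isCompl
  have hd : Disjoint A (C ⊓ B) := by
    rw [disjoint_iff, ← hC.inf_eq_bot]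
    ac_rfl
  obtain ⟨D, hBD, hAD⟩ := hd.symm.exists_isCompl
  have hAD := hAD.symm
  refine ⟨A.projection D hAD, A.projection_apply_mem hAD,
    fun u hu => A.projection_apply_of_mem_left hAD hu, fun u hu => ?_⟩
  have hB : (A ⊓ B) ⊔ C ⊓ B = B := by
    rw [← sup_inf_assoc_of_le C inf_le_right, hC.sup_eq_top, top_inf_eq]
  rw [← hB] at hu
  obtain ⟨x, hx, y, hy, rfl⟩ := Submodule.mem_sup.1 hu
  rw [map_add, A.projection_apply_of_mem_left hAD hx.1,
    A.projection_apply_of_mem_right hAD (hBD hy), add_zero]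
  exact hx.2

/-- A generalized inverse `s` of `S` can be chosen so that `1 - s ∘ S` preserves a given
subspace. -/
theorem LinearMap.exists_comp_comp_eq_self_of_submodule {K U P : Type*} [Field K]
    [AddCommGroup U] [Module K U] [AddCommGroup P] [Module K P] (S : U →ₗ[K] P)
    (B : Submodule K U) :
    ∃ s : P →ₗ[K] U, (∀ u, u - s (S u) ∈ LinearMap.ker S) ∧ ∀ u ∈ B, u - s (S u) ∈ B := by
  obtain ⟨r, hr⟩ := S.exists_comp_comp_eq_self
  obtain ⟨p, hpA, hp, hpB⟩ := (LinearMap.ker S).exists_projection_preserving B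
  have key (u : U) : u - (r (S u) - p (r (S u))) = p u := by
    have h := hp (u - r (S u)) (by simp [hr])
    rw [map_sub] at h
    rw [← sub_add, ← h]
    abel
  refine ⟨r - p ∘ₗ r, fun u => ?_, fun u hu => ?_⟩
  · simpa only [LinearMap.sub_apply, LinearMap.comp_apply, key] using hpA u
  · simpa only [LinearMap.sub_apply, LinearMap.comp_apply, key] using hpB u hu

theorem tmul_mem_subTensor {K U W : Type*} [Field K] [AddCommGroup U] [Module K U]
    [AddCommGroup W] [Module K W] {X : Submodule K U} {Y : Submodule K W} {x : U} {y : W}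
    (hx : x ∈ X) (hy : y ∈ Y) : x ⊗ₜ[K] y ∈ subTensor X Y :=
  Submodule.subset_span ⟨x, hx, y, hy, rfl⟩

theorem subTensor_le_ker_map {K U W P Q : Type*} [Field K]
    [AddCommGroup U] [Module K U] [AddCommGroup W] [Module K W]
    [AddCommGroup P] [Module K P] [AddCommGroup Q] [Module K Q]
    {S : U →ₗ[K] P} {T : W →ₗ[K] Q} {X : Submodule K U} {Y : Submodule K W}
    (h : X ≤ LinearMap.ker S ∨ Y ≤ LinearMap.ker T) :
    subTensor X Y ≤ LinearMap.ker (TensorProduct.map S T) := by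
  refine Submodule.span_le.2 ?_
  rintro _ ⟨x, hx, y, hy, rfl⟩
  rw [SetLike.mem_coe, LinearMap.mem_ker, TensorProduct.map_tmul]
  rcases h with h | h
  · rw [LinearMap.mem_ker.1 (h hx), TensorProduct.zero_tmul]
  · rw [LinearMap.mem_ker.1 (h hy), TensorProduct.tmul_zero]

/-- `Ker(S⊗T) ∩ Ker(S′⊗T′) = (Ker S ∩ Ker S′)⊗W + (Ker S)⊗(Ker T′) + (Ker S′)⊗(Ker T)
+ U⊗(Ker T ∩ Ker T′)` as subspaces of `U ⊗ W`. -/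
theorem ker_tensor_inter_ker_tensor {K U W P P' Q Q' : Type*} [Field K]
    [AddCommGroup U] [Module K U] [AddCommGroup W] [Module K W]
    [AddCommGroup P] [Module K P] [AddCommGroup P'] [Module K P']
    [AddCommGroup Q] [Module K Q] [AddCommGroup Q'] [Module K Q']
    (S : U →ₗ[K] P) (S' : U →ₗ[K] P') (T : W →ₗ[K] Q) (T' : W →ₗ[K] Q') :
    LinearMap.ker (TensorProduct.map S T) ⊓ LinearMap.ker (TensorProduct.map S' T')
    = subTensor (LinearMap.ker S ⊓ LinearMap.ker S') (⊤ : Submodule K W)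
      ⊔ subTensor (LinearMap.ker S) (LinearMap.ker T')
      ⊔ subTensor (LinearMap.ker S') (LinearMap.ker T)
      ⊔ subTensor (⊤ : Submodule K U) (LinearMap.ker T ⊓ LinearMap.ker T') := by
  apply le_antisymm
  · obtain ⟨s, hs, hsS'⟩ := S.exists_comp_comp_eq_self_of_submodule (LinearMap.ker S')
    obtain ⟨s', hs', -⟩ := S'.exists_comp_comp_eq_self_of_submodule ⊥
    obtain ⟨t, ht, htT'⟩ := T.exists_comp_comp_eq_self_of_submodule (LinearMap.ker T')
    obtain ⟨t', ht', -⟩ := T'.exists_comp_comp_eq_self_of_submodule ⊥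
    set N := subTensor (LinearMap.ker S ⊓ LinearMap.ker S') (⊤ : Submodule K W)
      ⊔ subTensor (LinearMap.ker S) (LinearMap.ker T')
      ⊔ subTensor (LinearMap.ker S') (LinearMap.ker T)
      ⊔ subTensor (⊤ : Submodule K U) (LinearMap.ker T ⊓ LinearMap.ker T')
    let F := LinearMap.id - TensorProduct.map s t ∘ₗ TensorProduct.map S T
    let F' := LinearMap.id - TensorProduct.map s' t' ∘ₗ TensorProduct.map S' T'
    have hF (z : U ⊗[K] W) : F (F' z) ∈ N := by
      induction z using TensorProduct.induction_on with
      | zero => simp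
      | add a b ha hb => simpa only [map_add] using N.add_mem ha hb
      | tmul u w =>
        let a := u - s' (S' u)
        let b := w - t' (T' w)
        have ha : a ∈ LinearMap.ker S' := hs' u
        have hb : b ∈ LinearMap.ker T' := ht' w
        have h₁ := tmul_mem_subTensor (K := K) (x := a - s (S a)) (y := w)
          (X := LinearMap.ker S ⊓ LinearMap.ker S') ⟨hs a, hsS' a ha⟩ Submodule.mem_top
        have h₂ := tmul_mem_subTensor (hs (s' (S' u))) hb
        have h₃ : s (S a) ⊗ₜ[K] (w - t (T w)) ∈
            subTensor (LinearMap.ker S') (LinearMap.ker T) := by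
          refine tmul_mem_subTensor ?_ (ht w)
          simpa using Submodule.sub_mem _ ha (hsS' a ha)
        have h₄ := tmul_mem_subTensor (K := K) (x := s (S (s' (S' u)))) (y := b - t (T b))
          (Y := LinearMap.ker T ⊓ LinearMap.ker T') Submodule.mem_top ⟨ht b, htT' b hb⟩
        have h := Submodule.add_mem_sup
          (Submodule.add_mem_sup (Submodule.add_mem_sup h₁ h₂) h₃) h₄
        convert h using 1
        simp only [F, F', a, b, LinearMap.sub_apply, LinearMap.id_apply, LinearMap.comp_apply,
          TensorProduct.map_tmul, map_sub, TensorProduct.tmul_sub, TensorProduct.sub_tmul]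
        abel
    rintro z ⟨hz, hz'⟩
    have h := hF z
    have hz : TensorProduct.map S T z = 0 := hz
    have hz' : TensorProduct.map S' T' z = 0 := hz'
    simpa [F, F', hz, hz'] using h
  · refine sup_le (sup_le (sup_le ?_ ?_) ?_) ?_ <;>
      refine le_inf (subTensor_le_ker_map ?_) (subTensor_le_ker_map ?_) <;> simp
end
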